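/- In the setup, for γ = (c, c_1, …, c_ℓ | j_1, …, j_ℓ) ∈ 𝒫_T(c,b)_{-i_0} define g(γ) = (a, d, c, c_1, …, c_ℓ | i_1, i_0, j_1, …, j_ℓ), i.e. prepend the two edges T_{i_1}, T_{i_0}. Then g is a well-defined bijection from 𝒫_T(c,b)_{-i_0} onto 𝒫_T(a,b)_{i_1 i_0}, and x(g(γ)) = (x_{i_1}/x_{i_0}) · x(γ) for every γ ∈ 𝒫_T(c,b)_{-i_0}. (Lemma 2.6, map g.) -/

import Mathlib

open scoped BigOperators Classical

noncomputable section

/-- The `k`-th vertex of the regular `(n+3)`-gon inscribed in the unit circle. -/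
def vtx (n : ℕ) (k : Fin (n + 3)) : EuclideanSpace ℝ (Fin 2) :=
  (WithLp.equiv 2 (Fin 2 → ℝ)).symm
    ![Real.cos (2 * Real.pi * k / (n + 3)), Real.sin (2 * Real.pi * k / (n + 3))]

/-- `u` and `v` are cyclically adjacent vertices of the `(n+3)`-gon. -/
def Adj (n : ℕ) (u v : Fin (n + 3)) : Prop :=
  (u.val + 1) % (n + 3) = v.val ∨ (v.val + 1) % (n + 3) = u.val

/-- The pair `(u, v)` is a diagonal of the polygon. -/
def IsDiag (n : ℕ) (u v : Fin (n + 3)) : Prop :=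
  u ≠ v ∧ ¬ Adj n u v

/-- The open segments joining `u,v` and `w,z` intersect (the two edges cross). -/
def Cross (n : ℕ) (u v w z : Fin (n + 3)) : Prop :=
  (openSegment ℝ (vtx n u) (vtx n v) ∩ openSegment ℝ (vtx n w) (vtx n z)).Nonempty

/-- `(u,v)` and `(w,z)` are the same unordered pair of vertices. -/
def SamePair (n : ℕ) (u v w z : Fin (n + 3)) : Prop :=
  (u = w ∧ v = z) ∨ (u = z ∧ v = w)

/-- A triangulation of the `(n+3)`-gon: `2n+3` edges, the first `n` of which are
pairwise noncrossing diagonals (a maximal such family), and the remaining `n+3`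
are the boundary edges. -/
structure Triangulation (n : ℕ) where
  src : Fin (2 * n + 3) → Fin (n + 3)
  tgt : Fin (2 * n + 3) → Fin (n + 3)
  diag : ∀ i : Fin (2 * n + 3), i.val < n → IsDiag n (src i) (tgt i)
  bdry : ∀ i : Fin (2 * n + 3), n ≤ i.val → Adj n (src i) (tgt i)
  inj : ∀ i j : Fin (2 * n + 3), SamePair n (src i) (tgt i) (src j) (tgt j) → i = j
  noncross : ∀ i j : Fin (2 * n + 3), i ≠ j → ¬ Cross n (src i) (tgt i) (src j) (tgt j)
  bdry_complete : ∀ u v : Fin (n + 3), Adj n u v →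
    ∃ i : Fin (2 * n + 3), n ≤ i.val ∧ SamePair n (src i) (tgt i) u v
  maximal : ∀ u v : Fin (n + 3), IsDiag n u v →
    (∀ i : Fin (2 * n + 3), i.val < n → ¬ Cross n u v (src i) (tgt i)) →
    ∃ i : Fin (2 * n + 3), i.val < n ∧ SamePair n (src i) (tgt i) u v

/-- The edge `T_i` joins the vertices `u` and `v`. -/
def Joins (n : ℕ) (T : Triangulation n) (i : Fin (2 * n + 3)) (u v : Fin (n + 3)) : Prop :=
  SamePair n (T.src i) (T.tgt i) u v

/-- The edge `T_i` crosses the segment from `u` to `v`. -/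
def ECross (n : ℕ) (T : Triangulation n) (i : Fin (2 * n + 3)) (u v : Fin (n + 3)) : Prop :=
  Cross n (T.src i) (T.tgt i) u v

/-- The set of crossing points of the edge `T_i` with the segment from `u` to `v`. -/
def crossPts (n : ℕ) (T : Triangulation n) (i : Fin (2 * n + 3)) (u v : Fin (n + 3)) :
    Set (EuclideanSpace ℝ (Fin 2)) :=
  openSegment ℝ (vtx n (T.src i)) (vtx n (T.tgt i)) ∩ openSegment ℝ (vtx n u) (vtx n v)

/-- A default edge index. -/
def edef (n : ℕ) : Fin (2 * n + 3) := ⟨0, by omega⟩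

/-- The data of a path: the list of vertices `a_0,…,a_ℓ` and the list of
edge indices `i_1,…,i_ℓ`. -/
abbrev PathData (n : ℕ) := List (Fin (n + 3)) × List (Fin (2 * n + 3))

/-- `p` is a `T`-path from `a` to `b`: conditions (T1)–(T6). -/
def IsTPath (n : ℕ) (T : Triangulation n) (a b : Fin (n + 3)) (p : PathData n) : Prop :=
  -- the vertex list has one more entry than the edge list
  p.1.length = p.2.length + 1 ∧
  -- (T1)
  p.1.head? = some a ∧ p.1.getLast? = some b ∧
  -- (T2)
  (∀ k, k < p.2.length →
      Joins n T (p.2.getD k (edef n)) (p.1.getD k a) (p.1.getD (k + 1) a)) ∧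
  -- (T3)
  p.2.Nodup ∧
  -- (T4)
  Odd p.2.length ∧
  -- (T5) (list position `k` carries the `(k+1)`-st edge of the path)
  (∀ k, k < p.2.length → k % 2 = 1 → ECross n T (p.2.getD k (edef n)) a b) ∧
  -- (T6)
  (∀ j k, j < k → k < p.2.length →
      ∀ x ∈ crossPts n T (p.2.getD j (edef n)) a b,
      ∀ y ∈ crossPts n T (p.2.getD k (edef n)) a b,
        dist (vtx n a) x < dist (vtx n a) y)

/-- `𝒫_T(a,b)`: the set of `T`-paths from `a` to `b`. -/
def TPaths (n : ℕ) (T : Triangulation n) (a b : Fin (n + 3)) : Set (PathData n) :=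
  { p | IsTPath n T a b p }

/-- `𝒫_T(a,b)_j`: `T`-paths from `a` to `b` whose first edge is `T_j`. -/
def TPathsFirst (n : ℕ) (T : Triangulation n) (a b : Fin (n + 3)) (j : Fin (2 * n + 3)) :
    Set (PathData n) :=
  { p ∈ TPaths n T a b | p.2.head? = some j }

/-- `𝒫_T(a,b)_{-j}`: `T`-paths from `a` to `b` not containing the index `j`. -/
def TPathsAvoid (n : ℕ) (T : Triangulation n) (a b : Fin (n + 3)) (j : Fin (2 * n + 3)) :
    Set (PathData n) :=
  { p ∈ TPaths n T a b | j ∉ p.2 }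

/-- `𝒫_T(a,b)_{jk}`: `T`-paths from `a` to `b` whose first two edges are `T_j, T_k`. -/
def TPathsFirst2 (n : ℕ) (T : Triangulation n) (a b : Fin (n + 3))
    (j k : Fin (2 * n + 3)) : Set (PathData n) :=
  { p ∈ TPathsFirst n T a b j | p.2[1]? = some k }

/-- `𝒫_T(a,b)_{j,-k}`: `T`-paths from `a` to `b` whose first edge is `T_j` and which do
not contain the index `k`. -/
def TPathsFirstAvoid (n : ℕ) (T : Triangulation n) (a b : Fin (n + 3))
    (j k : Fin (2 * n + 3)) : Set (PathData n) :=
  { p ∈ TPathsFirst n T a b j | k ∉ p.2 }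

/-- The ambient field `F = ℚ(x_1,…,x_{2n+3})`. -/
abbrev F (n : ℕ) := FractionRing (MvPolynomial (Fin (2 * n + 3)) ℚ)

/-- The variable `x_i ∈ F` attached to the edge `T_i`. -/
def X (n : ℕ) (i : Fin (2 * n + 3)) : F n :=
  algebraMap (MvPolynomial (Fin (2 * n + 3)) ℚ) (F n) (MvPolynomial.X i)

/-- `x(α)` for a path with edge list `es = [i_1,…,i_ℓ]`: the product of the
variables of the odd edges times the inverse of the product of the variables of
the even edges (list position `k` carries the `(k+1)`-st edge). -/
def pathX (n : ℕ) (es : List (Fin (2 * n + 3))) : F n :=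
  (∏ k ∈ (Finset.range es.length).filter (fun k => k % 2 = 0), X n (es.getD k (edef n))) *
  (∏ k ∈ (Finset.range es.length).filter (fun k => k % 2 = 1), X n (es.getD k (edef n)))⁻¹

end

/-- Twice the signed area of the triangle with vertices `p`, `q`, `x`. -/
def orient (p q x : EuclideanSpace ℝ (Fin 2)) : ℝ :=
  (q 0 - p 0) * (x 1 - p 1) - (q 1 - p 1) * (x 0 - p 0)

lemma orient_rotate (p q x : EuclideanSpace ℝ (Fin 2)) : orient p q x = orient q x p := by
  unfold orient; ring

lemma orient_swap (p q x : EuclideanSpace ℝ (Fin 2)) : orient q p x = -orient p q x := by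
  unfold orient; ring

lemma orient_left (p q : EuclideanSpace ℝ (Fin 2)) : orient p q p = 0 := by
  unfold orient; ring

lemma orient_right (p q : EuclideanSpace ℝ (Fin 2)) : orient p q q = 0 := by
  unfold orient; ring

lemma orient_combo (p q y z : EuclideanSpace ℝ (Fin 2)) {s t : ℝ} (hst : s + t = 1) :
    orient p q (s • y + t • z) = s * orient p q y + t * orient p q z := by
  obtain rfl : s = 1 - t := by linarith
  simp only [orient, PiLp.add_apply, PiLp.smul_apply, smul_eq_mul]
  ring

lemma orient_eq_zero_of_mem_openSegment {p q x : EuclideanSpace ℝ (Fin 2)}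
    (hx : x ∈ openSegment ℝ p q) : orient p q x = 0 := by
  obtain ⟨s, t, -, -, hst, rfl⟩ := hx
  rw [orient_combo p q p q hst, orient_left, orient_right]
  ring

lemma orient_vtx_pos {n : ℕ} {u v w : Fin (n + 3)} (huv : u < v) (hvw : v < w) :
    0 < orient (vtx n u) (vtx n v) (vtx n w) := by
  have hN : (0 : ℝ) < n + 3 := by positivity
  have key : ∀ x y : Fin (n + 3), x < y →
      0 < Real.sin (Real.pi * y / (n + 3) - Real.pi * x / (n + 3)) := by
    intro x y hxy
    have h1 : (x.val : ℝ) < y.val := by exact_mod_cast hxy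
    have h2 : (y.val : ℝ) < n + 3 := by exact_mod_cast y.isLt
    have h3 : (0 : ℝ) ≤ x.val := by positivity
    rw [← sub_div, ← mul_sub]
    apply Real.sin_pos_of_pos_of_lt_pi
    · have := Real.pi_pos
      have : (0 : ℝ) < y.val - x.val := by linarith
      positivity
    · rw [div_lt_iff₀ hN]
      exact mul_lt_mul_of_pos_left (by linarith) Real.pi_pos
  have hu := key u v huv
  have hv := key v w hvw
  have hw := key u w (huv.trans hvw)
  have hang : ∀ x : Fin (n + 3),
      2 * Real.pi * (x.val : ℝ) / (n + 3) = 2 * (Real.pi * x.val / (n + 3)) := by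
    intro x; ring
  have hform : orient (vtx n u) (vtx n v) (vtx n w) =
      4 * Real.sin (Real.pi * v / (n + 3) - Real.pi * u / (n + 3)) *
        Real.sin (Real.pi * w / (n + 3) - Real.pi * u / (n + 3)) *
        Real.sin (Real.pi * w / (n + 3) - Real.pi * v / (n + 3)) := by
    simp only [orient, vtx, WithLp.equiv_symm_apply, Matrix.cons_val_zero, Matrix.cons_val_one,
      Matrix.cons_val_fin_one, hang]
    generalize Real.pi * (u.val : ℝ) / (n + 3) = A
    generalize Real.pi * (v.val : ℝ) / (n + 3) = B
    generalize Real.pi * (w.val : ℝ) / (n + 3) = C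
    have e : C - B = (C + A) - (B + A) := by ring
    rw [Real.cos_sub_cos, Real.cos_sub_cos, Real.sin_sub_sin, Real.sin_sub_sin, e,
      Real.sin_sub (C + A) (B + A)]
    have h1 : (2 * B - 2 * A) / 2 = B - A := by ring
    have h2 : (2 * C - 2 * A) / 2 = C - A := by ring
    have h3 : (2 * B + 2 * A) / 2 = B + A := by ring
    have h4 : (2 * C + 2 * A) / 2 = C + A := by ring
    rw [h1, h2, h3, h4]
    ring
  rw [hform]
  positivity

/-- `r` numbers the vertices consecutively around the polygon, counterclockwise if `ε > 0` and
clockwise if `ε < 0`. -/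
structure IsNumbering (n : ℕ) (r : Fin (n + 3) → ℕ) (ε : ℝ) : Prop where
  injective : Function.Injective r
  pos : ∀ {u v w : Fin (n + 3)}, r u < r v → r v < r w →
    0 < ε * orient (vtx n u) (vtx n v) (vtx n w)

lemma exists_isNumbering {n : ℕ} {a c d : Fin (n + 3)} (had : a ≠ d)
    (hcd : c ≠ d) : ∃ r ε, IsNumbering n r ε ∧ r a = 0 ∧ r c < r d := by
  have cyc : ∀ u v w : Fin (n + 3), (u < v ∧ v < w) ∨ (v < w ∧ w < u) ∨ (w < u ∧ u < v) →
      0 < orient (vtx n u) (vtx n v) (vtx n w) := by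
    rintro u v w (⟨h, h'⟩ | ⟨h, h'⟩ | ⟨h, h'⟩)
    · exact orient_vtx_pos h h'
    · rw [orient_rotate]; exact orient_vtx_pos h h'
    · rw [orient_rotate, orient_rotate]; exact orient_vtx_pos h h'
  let r : Fin (n + 3) → ℕ := fun u => if a.val ≤ u.val then u - a else u + (n + 3) - a
  let r' : Fin (n + 3) → ℕ := fun u => if u.val ≤ a.val then a - u else a + (n + 3) - u
  have hr : IsNumbering n r 1 := by
    refine ⟨fun u v h => ?_, fun {u v w} h h' => ?_⟩
    · have := u.isLt; have := v.isLt; have := a.isLt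
      simp only [r] at h
      ext
      split_ifs at h <;> omega
    · rw [one_mul]
      apply cyc
      have := u.isLt; have := v.isLt; have := a.isLt; have := w.isLt
      simp only [r] at h h'
      simp only [Fin.lt_def]
      split_ifs at h h' <;> omega
  have hr' : IsNumbering n r' (-1) := by
    refine ⟨fun u v h => ?_, fun {u v w} h h' => ?_⟩
    · have := u.isLt; have := v.isLt; have := a.isLt
      simp only [r'] at h
      ext
      split_ifs at h <;> omega
    · rw [neg_one_mul, ← orient_swap]
      apply cyc
      have := u.isLt; have := v.isLt; have := a.isLt; have := w.isLt
      simp only [r'] at h h'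
      simp only [Fin.lt_def]
      split_ifs at h h' <;> omega
  by_cases h : r c < r d
  · exact ⟨r, 1, hr, by simp [r], h⟩
  · refine ⟨r', -1, hr', by simp [r'], ?_⟩
    rw [Ne, Fin.ext_iff] at had hcd
    have := c.isLt; have := d.isLt; have := a.isLt
    simp only [r] at h
    simp only [r']
    split_ifs at h ⊢ <;> omega

section Chords

variable {n : ℕ} {r : Fin (n + 3) → ℕ} {ε : ℝ}

lemma IsNumbering.orient_pos_of_lt_left (hr : IsNumbering n r ε) {u v w : Fin (n + 3)}
    (h : r u < r v) (hw : r w < r u) : 0 < ε * orient (vtx n u) (vtx n v) (vtx n w) := by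
  rw [orient_rotate, orient_rotate]; exact hr.pos hw h

lemma IsNumbering.orient_neg_of_between (hr : IsNumbering n r ε) {u v w : Fin (n + 3)}
    (hu : r u < r w) (hv : r w < r v) : ε * orient (vtx n u) (vtx n v) (vtx n w) < 0 := by
  rw [orient_rotate, orient_rotate, orient_swap (vtx n u), mul_neg, neg_lt_zero]
  exact hr.pos hu hv

lemma IsNumbering.orient_nonpos (hr : IsNumbering n r ε) {u v w : Fin (n + 3)}
    (hu : r u ≤ r w) (hv : r w ≤ r v) : ε * orient (vtx n u) (vtx n v) (vtx n w) ≤ 0 := by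
  rcases hu.eq_or_lt with h | h
  · rw [hr.injective h, orient_left, mul_zero]
  rcases hv.eq_or_lt with h' | h'
  · rw [hr.injective h', orient_right, mul_zero]
  exact (hr.orient_neg_of_between h h').le

lemma IsNumbering.orient_nonneg (hr : IsNumbering n r ε) {u v w : Fin (n + 3)} (huv : r u < r v)
    (hw : r w ≤ r u ∨ r v ≤ r w) : 0 ≤ ε * orient (vtx n u) (vtx n v) (vtx n w) := by
  rcases hw with h | h <;> rcases h.eq_or_lt with h | h
  · rw [hr.injective h, orient_left, mul_zero]
  · exact (hr.orient_pos_of_lt_left huv h).le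
  · rw [← hr.injective h, orient_right, mul_zero]
  · exact (hr.pos huv h).le

lemma combo_pos_of_nonneg {s t y z : ℝ} (hs : 0 < s) (ht : 0 < t) (hy : 0 ≤ y) (hz : 0 ≤ z)
    (h : 0 < y ∨ 0 < z) : 0 < s * y + t * z := by
  rcases h with h | h <;> positivity

lemma Cross.symm {u v w z : Fin (n + 3)} (h : Cross n u v w z) : Cross n w z u v := by
  unfold Cross at *; rwa [Set.inter_comm]

lemma IsNumbering.cross_of_interleave (hr : IsNumbering n r ε) {u v w z : Fin (n + 3)}
    (huw : r u < r w) (hwv : r w < r v) (hvz : r v < r z) : Cross n u v w z := by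
  have hA := hr.orient_neg_of_between huw hwv
  have hB := hr.pos (huw.trans hwv) hvz
  have hC := hr.orient_pos_of_lt_left (hwv.trans hvz) huw
  have hE := hr.orient_neg_of_between hwv hvz
  have hAB : ε * orient (vtx n u) (vtx n v) (vtx n z) - ε * orient (vtx n u) (vtx n v) (vtx n w)
      = ε * orient (vtx n w) (vtx n z) (vtx n u) - ε * orient (vtx n w) (vtx n z) (vtx n v) := by
    unfold orient; ring
  set D := ε * orient (vtx n u) (vtx n v) (vtx n z) - ε * orient (vtx n u) (vtx n v) (vtx n w)
    with hD
  have hDpos : 0 < D := by linarith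
  refine ⟨(-(ε * orient (vtx n w) (vtx n z) (vtx n v)) / D) • vtx n u +
    (ε * orient (vtx n w) (vtx n z) (vtx n u) / D) • vtx n v,
    ⟨_, _, div_pos (by linarith) hDpos, div_pos hC hDpos, ?_, rfl⟩,
    ⟨ε * orient (vtx n u) (vtx n v) (vtx n z) / D, -(ε * orient (vtx n u) (vtx n v) (vtx n w)) / D,
      div_pos hB hDpos, div_pos (by linarith) hDpos, ?_, ?_⟩⟩
  · rw [← add_div, div_eq_one_iff_eq hDpos.ne']; linarith
  · rw [← add_div, div_eq_one_iff_eq hDpos.ne']; linarith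
  · ext i
    fin_cases i <;>
    · simp only [PiLp.add_apply, PiLp.smul_apply, smul_eq_mul, div_mul_eq_mul_div, ← add_div]
      congr 1
      simp only [orient, Fin.zero_eta, Fin.mk_one]
      ring

lemma IsNumbering.cross_iff (hr : IsNumbering n r ε) {u v w z : Fin (n + 3)}
    (huv : r u < r v) (hwz : r w < r z) (hne : u ≠ w ∨ v ≠ z) :
    Cross n u v w z ↔
      (r u < r w ∧ r w < r v ∧ r v < r z) ∨ (r w < r u ∧ r u < r z ∧ r z < r v) := by
  constructor
  · rintro ⟨x, hx, s, t, hs, ht, hst, rfl⟩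
    have h0 := orient_eq_zero_of_mem_openSegment hx
    rw [orient_combo _ _ _ _ hst] at h0
    have h0' : s * (ε * orient (vtx n u) (vtx n v) (vtx n w)) +
        t * (ε * orient (vtx n u) (vtx n v) (vtx n z)) = 0 := by
      linear_combination ε * h0
    have hne' : r u ≠ r w ∨ r v ≠ r z := hne.imp hr.injective.ne hr.injective.ne
    by_contra hcon
    have hcases : (r u ≤ r w ∧ r z ≤ r v) ∨
        ((r w ≤ r u ∨ r v ≤ r w) ∧ (r z ≤ r u ∨ r v ≤ r z)) := by omega
    rcases hcases with ⟨h1, h2⟩ | ⟨h1, h2⟩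
    · have e1 := hr.orient_nonpos h1 (hwz.le.trans h2)
      have e2 := hr.orient_nonpos (h1.trans hwz.le) h2
      have := combo_pos_of_nonneg hs ht (neg_nonneg.2 e1) (neg_nonneg.2 e2) (by
        rcases hne' with h | h
        · exact .inl (neg_pos.2 (hr.orient_neg_of_between (by omega) (by omega)))
        · exact .inr (neg_pos.2 (hr.orient_neg_of_between (by omega) (by omega))))
      linarith
    · have e1 := hr.orient_nonneg huv h1
      have e2 := hr.orient_nonneg huv h2
      have := combo_pos_of_nonneg hs ht e1 e2 (by
        have : r w < r u ∨ r v < r w ∨ r z < r u ∨ r v < r z := by omega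
        rcases this with h | h | h | h
        · exact .inl (hr.orient_pos_of_lt_left huv h)
        · exact .inl (hr.pos huv h)
        · exact .inr (hr.orient_pos_of_lt_left huv h)
        · exact .inr (hr.pos huv h))
      linarith
  · rintro (⟨h1, h2, h3⟩ | ⟨h1, h2, h3⟩)
    · exact hr.cross_of_interleave h1 h2 h3
    · exact (hr.cross_of_interleave h1 h2 h3).symm

/-- Of two nested chords meeting the segment from `p` to `q`, the outer one meets it closer
to `p`. -/
lemma IsNumbering.dist_lt_dist (hr : IsNumbering n r ε) {p q e f e' f' : Fin (n + 3)}
    (hp : r p < r e) (he : r e ≤ r e') (hef : r e' < r f') (hf : r f' ≤ r f)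
    (hne : e ≠ e' ∨ f ≠ f') {x x' : EuclideanSpace ℝ (Fin 2)}
    (hx : x ∈ openSegment ℝ (vtx n e) (vtx n f)) (hxpq : x ∈ openSegment ℝ (vtx n p) (vtx n q))
    (hx' : x' ∈ openSegment ℝ (vtx n e') (vtx n f'))
    (hxpq' : x' ∈ openSegment ℝ (vtx n p) (vtx n q)) :
    dist (vtx n p) x < dist (vtx n p) x' := by
  have hne' : r e ≠ r e' ∨ r f ≠ r f' := hne.imp hr.injective.ne hr.injective.ne
  have hP := hr.orient_pos_of_lt_left (w := p) (show r e < r f by omega) hp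
  have hlt : ε * orient (vtx n e) (vtx n f) x' < 0 := by
    obtain ⟨s, t, hs, ht, hst, rfl⟩ := hx'
    rw [orient_combo _ _ _ _ hst]
    have e1 := hr.orient_nonpos (v := f) he (by omega)
    have e2 := hr.orient_nonpos (u := e) (by omega) hf
    have := combo_pos_of_nonneg hs ht (neg_nonneg.2 e1) (neg_nonneg.2 e2) (by
      rcases hne' with h | h
      · exact .inl (neg_pos.2 (hr.orient_neg_of_between (by omega) (by omega)))
      · exact .inr (neg_pos.2 (hr.orient_neg_of_between (by omega) (by omega))))
    linarith
  have hzero := orient_eq_zero_of_mem_openSegment hx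
  obtain ⟨s, t, hs, ht, hst, rfl⟩ := hxpq
  obtain ⟨s', t', hs', ht', hst', rfl⟩ := hxpq'
  rw [orient_combo _ _ _ _ hst] at hzero
  rw [orient_combo _ _ _ _ hst'] at hlt
  have hQ : s * (ε * orient (vtx n e) (vtx n f) (vtx n p)) +
      t * (ε * orient (vtx n e) (vtx n f) (vtx n q)) = 0 := by linear_combination ε * hzero
  set P := ε * orient (vtx n e) (vtx n f) (vtx n p)
  set Q := ε * orient (vtx n e) (vtx n f) (vtx n q) with hQdef
  have hlt' : s' * P + t' * Q < 0 := by
    linarith [hlt]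
  have hQneg : Q < 0 := by
    by_contra! h
    nlinarith [mul_pos hs hP, mul_nonneg ht.le h]
  have htt : t < t' := by
    by_contra! h
    have h1 : s ≤ s' := by linarith
    nlinarith [mul_nonneg (sub_nonneg.2 h1) hP.le,
      mul_nonneg (sub_nonneg.2 h) (neg_nonneg.2 hQneg.le)]
  have hpq : vtx n p ≠ vtx n q := by
    intro h
    have : P = Q := by rw [hQdef, ← h]
    linarith
  have hd : ∀ {s t : ℝ}, s + t = 1 → 0 < t →
      dist (vtx n p) (s • vtx n p + t • vtx n q) = t * dist (vtx n p) (vtx n q) := by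
    intro s t hst ht
    obtain rfl : s = 1 - t := by linarith
    rw [← AffineMap.lineMap_apply_module, dist_left_lineMap, Real.norm_of_nonneg ht.le]
  rw [hd hst ht, hd hst' ht']
  exact mul_lt_mul_of_pos_right htt (dist_pos.2 hpq)

end Chords

section Edges

variable {n : ℕ} {T : Triangulation n} {r : Fin (n + 3) → ℕ} {ε : ℝ}

lemma Joins.symm {i : Fin (2 * n + 3)} {u v : Fin (n + 3)} (h : Joins n T i u v) :
    Joins n T i v u := by
  unfold Joins SamePair at *; tauto

lemma Joins.samePair {i : Fin (2 * n + 3)} {u v w z : Fin (n + 3)} (h : Joins n T i u v)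
    (h' : Joins n T i w z) : SamePair n u v w z := by
  unfold Joins SamePair at *; grind

lemma Joins.index_eq {i j : Fin (2 * n + 3)} {u v : Fin (n + 3)} (h : Joins n T i u v)
    (h' : Joins n T j u v) : i = j := by
  apply T.inj
  unfold Joins SamePair at *; grind

lemma Joins.ne {i : Fin (2 * n + 3)} {u v : Fin (n + 3)} (h : Joins n T i u v) : u ≠ v := by
  have hst : T.src i ≠ T.tgt i := by
    rcases lt_or_ge i.val n with hi | hi
    · exact (T.diag i hi).1
    · intro he
      have := (T.src i).isLt
      have hb := T.bdry i hi
      rw [he] at hb this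
      unfold Adj at hb
      rw [or_self] at hb
      rcases Nat.lt_or_ge ((T.tgt i).val + 1) (n + 3) with h1 | h1
      · rw [Nat.mod_eq_of_lt h1] at hb; omega
      · rw [show (T.tgt i).val + 1 = n + 3 by omega, Nat.mod_self] at hb; omega
  unfold Joins SamePair at h
  grind

lemma Joins.openSegment_eq {i : Fin (2 * n + 3)} {e f : Fin (n + 3)} (h : Joins n T i e f) :
    openSegment ℝ (vtx n (T.src i)) (vtx n (T.tgt i)) = openSegment ℝ (vtx n e) (vtx n f) := by
  rcases h with ⟨h, h'⟩ | ⟨h, h'⟩ <;> rw [h, h']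
  exact openSegment_symm ..

lemma Joins.eCross_iff {i : Fin (2 * n + 3)} {e f u v : Fin (n + 3)} (h : Joins n T i e f) :
    ECross n T i u v ↔ Cross n e f u v := by
  unfold ECross Cross; rw [h.openSegment_eq]

lemma Joins.mem_crossPts {i : Fin (2 * n + 3)} {e f u v : Fin (n + 3)} (h : Joins n T i e f)
    {x : EuclideanSpace ℝ (Fin 2)} : x ∈ crossPts n T i u v ↔
      x ∈ openSegment ℝ (vtx n e) (vtx n f) ∧ x ∈ openSegment ℝ (vtx n u) (vtx n v) := by
  unfold crossPts; rw [h.openSegment_eq]; rfl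

lemma eCross_of_mem_crossPts {i : Fin (2 * n + 3)} {u v : Fin (n + 3)}
    {x : EuclideanSpace ℝ (Fin 2)} (hx : x ∈ crossPts n T i u v) : ECross n T i u v :=
  ⟨x, hx⟩

lemma Joins.not_cross {i j : Fin (2 * n + 3)} {u v w z : Fin (n + 3)} (h : Joins n T i u v)
    (h' : Joins n T j w z) (hij : i ≠ j) : ¬ Cross n u v w z := by
  rw [← h.eCross_iff]
  have := T.noncross i j hij
  unfold ECross
  unfold Cross at *
  rwa [h'.openSegment_eq] at this

lemma IsNumbering.exists_joins (hr : IsNumbering n r ε) (i : Fin (2 * n + 3)) :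
    ∃ e f, r e < r f ∧ Joins n T i e f := by
  have h : Joins n T i (T.src i) (T.tgt i) := .inl ⟨rfl, rfl⟩
  rcases (hr.injective.ne h.ne).lt_or_gt with hlt | hlt
  · exact ⟨_, _, hlt, h⟩
  · exact ⟨_, _, hlt, h.symm⟩

lemma IsNumbering.not_interleave (hr : IsNumbering n r ε) {i j : Fin (2 * n + 3)}
    {u v w z : Fin (n + 3)} (h : Joins n T i u v) (h' : Joins n T j w z)
    (huw : r u < r w) (hwv : r w < r v) (hvz : r v < r z) : False := by
  refine h.not_cross h' ?_ (hr.cross_of_interleave huw hwv hvz)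
  rintro rfl
  rcases h.samePair h' with ⟨rfl, -⟩ | ⟨rfl, -⟩ <;> omega

/-- If `T_i` meets the segment from `q` to `b` before `T_i'` does, then the first endpoint of
`T_i` does not come after the first endpoint of `T_i'`. -/
lemma IsNumbering.left_le_of_closer (hr : IsNumbering n r ε) {i i' : Fin (2 * n + 3)}
    {q b e f e' f' : Fin (n + 3)} (hi : Joins n T i e f) (hi' : Joins n T i' e' f')
    (heb : r e < r b) (hbf : r b < r f) (heb' : r e' < r b) (hbf' : r b < r f')
    (hq : r q < r e) (hq' : r q < r e')
    (H : ∀ x ∈ crossPts n T i q b, ∀ y ∈ crossPts n T i' q b,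
      dist (vtx n q) x < dist (vtx n q) y) : r e ≤ r e' := by
  by_contra! hlt
  obtain ⟨x, hx⟩ := (hr.cross_of_interleave hq heb hbf).symm
  obtain ⟨y, hy⟩ := (hr.cross_of_interleave hq' heb' hbf').symm
  have hf : r f ≤ r f' := by
    by_contra! h
    exact hr.not_interleave hi' hi hlt (by omega) h
  have h1 := H x (hi.mem_crossPts.2 hx) y (hi'.mem_crossPts.2 hy)
  have h2 := hr.dist_lt_dist hq' hlt.le (by omega) hf (.inl fun h => hlt.ne (h ▸ rfl))
    hy.1 hy.2 hx.1 hx.2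
  exact lt_asymm h1 h2

/-- The order in which two edges meet the segments from `p` and from `q` to `b` is the same. -/
lemma IsNumbering.closer_transfer (hr : IsNumbering n r ε) {i i' : Fin (2 * n + 3)}
    {p q b e f e' f' : Fin (n + 3)} (hne : i ≠ i') (hi : Joins n T i e f)
    (hi' : Joins n T i' e' f') (heb : r e < r b) (hbf : r b < r f) (heb' : r e' < r b)
    (hbf' : r b < r f') (hp : r p < r e) (hq' : r q < r e')
    (H : ∀ x ∈ crossPts n T i q b, ∀ y ∈ crossPts n T i' q b,
      dist (vtx n q) x < dist (vtx n q) y) :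
    ∀ x ∈ crossPts n T i p b, ∀ y ∈ crossPts n T i' p b,
      dist (vtx n p) x < dist (vtx n p) y := by
  intro x hx y hy
  have hee : r e ≤ r e' := by
    by_contra! hlt
    have := hr.left_le_of_closer hi hi' heb hbf heb' hbf' (hq'.trans hlt) hq' H
    omega
  rw [hi.mem_crossPts] at hx
  rw [hi'.mem_crossPts] at hy
  have hne' : e ≠ e' ∨ f ≠ f' := by
    by_contra! h
    exact hne (hi.index_eq (h.1 ▸ h.2 ▸ hi'))
  rcases hee.eq_or_lt with h | h
  · by_cases hf : r f' ≤ r f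
    · exact hr.dist_lt_dist hp hee (by omega) hf hne' hx.1 hx.2 hy.1 hy.2
    · exfalso
      obtain ⟨x, hx⟩ := (hr.cross_of_interleave (h ▸ hq' : r q < r e) heb hbf).symm
      obtain ⟨y, hy⟩ := (hr.cross_of_interleave hq' heb' hbf').symm
      have h1 := H x (hi.mem_crossPts.2 hx) y (hi'.mem_crossPts.2 hy)
      have h2 := hr.dist_lt_dist hq' h.symm.le (by omega) (by omega) (by tauto)
        hy.1 hy.2 hx.1 hx.2
      exact lt_asymm h1 h2
  · refine hr.dist_lt_dist hp hee (by omega) ?_ hne' hx.1 hx.2 hy.1 hy.2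
    by_contra! hf
    exact hr.not_interleave hi hi' h (by omega) hf

end Edges

/-- The triangle `a, c, d` of `T`, cut by the segment from `a` to `b` through its side `T_{i0}`,
with the vertices numbered starting from `a` towards `c`. -/
structure CutTriangle (n : ℕ) (T : Triangulation n) (r : Fin (n + 3) → ℕ) (ε : ℝ)
    (a b c d : Fin (n + 3)) (i0 i1 : Fin (2 * n + 3)) : Prop where
  numbering : IsNumbering n r ε
  base : ∀ u, r a ≤ r u
  base_lt : r a < r c
  left_lt : r c < r b
  lt_right : r b < r d
  joins_cd : Joins n T i0 c d
  joins_ad : Joins n T i1 a d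
  exists_joins_ac : ∃ i, Joins n T i a c
  not_joins_ab : ∀ i, ¬ Joins n T i a b

section Paths

variable {n : ℕ} {T : Triangulation n} {r : Fin (n + 3) → ℕ} {ε : ℝ} {a b c d : Fin (n + 3)}
  {i0 i1 : Fin (2 * n + 3)}

lemma CutTriangle.bounds_of_eCross_ab (S : CutTriangle n T r ε a b c d i0 i1)
    {i : Fin (2 * n + 3)} {e f : Fin (n + 3)} (hef : r e < r f) (hi : Joins n T i e f)
    (h : ECross n T i a b) : r c ≤ r e ∧ r e < r b ∧ r b < r f ∧ r f ≤ r d := by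
  have hc := S.base_lt
  have hb := S.left_lt
  have hd := S.lt_right
  have he := S.base e
  rw [hi.eCross_iff, S.numbering.cross_iff hef (by omega) (by
    by_contra! h; exact S.not_joins_ab i (h.1 ▸ h.2 ▸ hi))] at h
  obtain ⟨i', hi'⟩ := S.exists_joins_ac
  have h1 : ¬ (r a < r e ∧ r e < r c ∧ r c < r f) := fun ⟨h, h', h''⟩ =>
    S.numbering.not_interleave hi' hi h h' h''
  have h2 : ¬ (r a < r e ∧ r e < r d ∧ r d < r f) := fun ⟨h, h', h''⟩ =>
    S.numbering.not_interleave S.joins_ad hi h h' h''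
  omega

lemma CutTriangle.bounds_of_eCross_cb (S : CutTriangle n T r ε a b c d i0 i1)
    {i : Fin (2 * n + 3)} {e f : Fin (n + 3)} (hef : r e < r f) (hi : Joins n T i e f)
    (hne : ¬ Joins n T i c b) (h : ECross n T i c b) :
    r c < r e ∧ r e < r b ∧ r b < r f ∧ r f ≤ r d := by
  have hc := S.base_lt
  have hb := S.left_lt
  have hd := S.lt_right
  rw [hi.eCross_iff, S.numbering.cross_iff hef hb (by
    by_contra! h; exact hne (h.1 ▸ h.2 ▸ hi))] at h
  have h1 : ¬ (r e < r c ∧ r c < r f ∧ r f < r d) := fun ⟨h, h', h''⟩ =>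
    S.numbering.not_interleave hi S.joins_cd h h' h''
  have h2 : ¬ (r a < r e ∧ r e < r d ∧ r d < r f) := fun ⟨h, h', h''⟩ =>
    S.numbering.not_interleave S.joins_ad hi h h' h''
  omega

lemma not_eCross_of_joins {i j : Fin (2 * n + 3)} (hi : Joins n T i c b) (hij : j ≠ i) :
    ¬ ECross n T j c b := by
  have h : Joins n T j (T.src j) (T.tgt j) := .inl ⟨rfl, rfl⟩
  rw [h.eCross_iff]
  exact h.not_cross hi hij

lemma eCross_ab_of_bounds (hr : IsNumbering n r ε) {i : Fin (2 * n + 3)} {e f : Fin (n + 3)}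
    (hi : Joins n T i e f) (hae : r a < r e) (heb : r e < r b) (hbf : r b < r f) :
    ECross n T i a b :=
  hi.eCross_iff.2 (hr.cross_of_interleave hae heb hbf).symm

lemma getD_congr {α : Type*} (l : List α) {k : ℕ} {x y : α} (hk : k < l.length) :
    l.getD k x = l.getD k y := by
  rw [List.getD_eq_getElem _ _ hk, List.getD_eq_getElem _ _ hk]

lemma IsTPath.getD_ne {p : PathData n} (h : IsTPath n T a b p) {j k : ℕ} (hjk : j < k)
    (hk : k < p.2.length) : p.2.getD j (edef n) ≠ p.2.getD k (edef n) := by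
  obtain ⟨-, -, -, -, hnd, -⟩ := h
  rw [List.getD_eq_getElem _ _ hk, List.getD_eq_getElem _ _ (hjk.trans hk)]
  intro he
  exact hjk.ne ((hnd.getElem_inj_iff).1 he)

lemma IsTPath.getD_zero {p : PathData n} (h : IsTPath n T a b p) (x : Fin (n + 3)) :
    p.1.getD 0 x = a := by
  rcases p with ⟨_ | ⟨v, vs⟩, es⟩
  · simp [IsTPath] at h
  · simpa [IsTPath] using h.2.1

lemma IsTPath.getD_length {p : PathData n} (h : IsTPath n T a b p) (x : Fin (n + 3)) :
    p.1.getD p.2.length x = b := by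
  obtain ⟨hl, -, hb, -⟩ := h
  rw [List.getLast?_eq_getElem?, hl, Nat.add_sub_cancel] at hb
  rw [List.getD_eq_getElem?_getD, hb, Option.getD_some]

/-- Every edge in an odd list position of a path from `c` to `b` has one endpoint strictly between
`c` and `b`, and the other after `b` and up to `d`. -/
lemma CutTriangle.bounds_of_odd (S : CutTriangle n T r ε a b c d i0 i1) {p : PathData n}
    (h : IsTPath n T c b p) {k : ℕ} (hk : k < p.2.length) (hodd : k % 2 = 1)
    {e f : Fin (n + 3)} (hef : r e < r f) (hi : Joins n T (p.2.getD k (edef n)) e f) :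
    r c < r e ∧ r e < r b ∧ r b < r f ∧ r f ≤ r d := by
  have ⟨_, _, _, hj, _, _, h5, _⟩ := h
  refine S.bounds_of_eCross_cb hef hi (fun hcb => ?_) (h5 k hk hodd)
  obtain rfl : k = 1 := by
    by_contra hk1
    exact not_eCross_of_joins hcb (h.getD_ne (by omega : 1 < k) hk) (h5 1 (by omega) rfl)
  have j0 := hj 0 (by omega)
  have j1 := hj 1 (by omega)
  rw [h.getD_zero] at j0
  have hv : p.1.getD (0 + 1) c = b := by
    rcases hcb.samePair j1 with ⟨h', -⟩ | ⟨-, h'⟩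
    · exact absurd h' j0.ne
    · exact h'.symm
  rw [hv] at j0
  exact h.getD_ne one_pos hk (j0.index_eq hcb)

lemma CutTriangle.lt_vertex (S : CutTriangle n T r ε a b c d i0 i1) {p : PathData n}
    (h : IsTPath n T c b p) {k : ℕ} (hk0 : 1 ≤ k) (hk : k ≤ p.2.length) :
    r c < r (p.1.getD k c) := by
  rcases hk.eq_or_lt with rfl | hk
  · rw [h.getD_length]; exact S.left_lt
  have hj := h.2.2.2.1
  obtain ⟨m, w, hm, hodd, hmw⟩ : ∃ m w, m < p.2.length ∧ m % 2 = 1 ∧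
      Joins n T (p.2.getD m (edef n)) (p.1.getD k c) w := by
    rcases Nat.mod_two_eq_zero_or_one k with h0 | h1
    · obtain ⟨k, rfl⟩ := Nat.exists_eq_add_of_le' hk0
      exact ⟨k, _, by omega, by omega, (hj k (by omega)).symm⟩
    · exact ⟨k, _, hk, h1, hj k hk⟩
  rcases (S.numbering.injective.ne hmw.ne).lt_or_gt with hlt | hlt
  · exact (S.bounds_of_odd h hm hodd hlt hmw).1
  · exact (S.bounds_of_odd h hm hodd hlt hmw.symm).1.trans hlt

lemma CutTriangle.notMem_path (S : CutTriangle n T r ε a b c d i0 i1) {p : PathData n}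
    (h : IsTPath n T c b p) : i1 ∉ p.2 := by
  intro hmem
  obtain ⟨k, hk, hki⟩ := List.getElem_of_mem hmem
  have hj := h.2.2.2.1 k hk
  rw [List.getD_eq_getElem _ _ hk, hki] at hj
  have h2 := S.lt_vertex h (by omega : 1 ≤ k + 1) hk
  have hc := S.base_lt
  rcases hj.samePair S.joins_ad with ⟨h1, -⟩ | ⟨-, h1⟩
  · rcases Nat.eq_zero_or_pos k with rfl | hk0
    · rw [h.getD_zero] at h1
      rw [h1] at hc; omega
    · have := S.lt_vertex h hk0 hk.le
      rw [h1] at this; omega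
  · rw [h1] at h2; omega

/-- Among the edges of `T`, `T_{i0}` meets the segment from `a` to `b` closest to `a`. -/
lemma CutTriangle.dist_lt_of_ne (S : CutTriangle n T r ε a b c d i0 i1)
    {i : Fin (2 * n + 3)} (hi : i ≠ i0) : ∀ x ∈ crossPts n T i0 a b,
    ∀ y ∈ crossPts n T i a b, dist (vtx n a) x < dist (vtx n a) y := by
  intro x hx y hy
  obtain ⟨e, f, hef, hj⟩ := S.numbering.exists_joins (T := T) i
  obtain ⟨h1, h2, h3, h4⟩ := S.bounds_of_eCross_ab hef hj (eCross_of_mem_crossPts hy)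
  rw [S.joins_cd.mem_crossPts] at hx
  rw [hj.mem_crossPts] at hy
  refine S.numbering.dist_lt_dist S.base_lt h1 hef h4 ?_ hx.1 hx.2 hy.1 hy.2
  by_contra! h
  exact hi (hj.index_eq (h.1 ▸ h.2 ▸ S.joins_cd))

lemma CutTriangle.crossPts_first_eq_empty (S : CutTriangle n T r ε a b c d i0 i1) :
    crossPts n T i1 a b = ∅ := by
  rw [Set.eq_empty_iff_forall_notMem]
  intro x hx
  have hc := S.base_lt
  have hb := S.left_lt
  have := S.bounds_of_eCross_ab (by have := S.lt_right; omega) S.joins_ad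
    (eCross_of_mem_crossPts hx)
  omega

lemma CutTriangle.isTPath_cons_cons (S : CutTriangle n T r ε a b c d i0 i1)
    (hcross : ECross n T i0 a b) {vs : List (Fin (n + 3))} {es : List (Fin (2 * n + 3))}
    (h : IsTPath n T c b (vs, es)) (hi0 : i0 ∉ es) :
    IsTPath n T a b (a :: d :: vs, i1 :: i0 :: es) := by
  have h' := h
  obtain ⟨hl, hhead, hlast, hj, hnd, hodd, h5, h6⟩ := h'
  dsimp only at hl hhead hlast hj hnd hodd h5 h6
  obtain ⟨vs, rfl⟩ : ∃ l, vs = c :: l := by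
    cases vs <;> simp_all
  have hc := S.base_lt
  have hi10 : i1 ≠ i0 := by
    rintro rfl
    rcases S.joins_ad.samePair S.joins_cd with ⟨h, -⟩ | ⟨h, -⟩
    · rw [h] at hc; omega
    · exact S.joins_ad.ne h
  refine ⟨by simpa using hl, rfl, by simpa using hlast, ?_, ?_, ?_, ?_, ?_⟩
  · rintro (_ | _ | k) hk
    · exact S.joins_ad
    · exact S.joins_cd.symm
    · simp only [List.length_cons] at hk hl
      simp only [List.getD_cons_succ]
      have := hj k (by omega)
      rwa [getD_congr (c :: vs) (x := c) (y := a) (by simp; omega),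
        getD_congr (c :: vs) (x := c) (y := a) (by simp; omega)] at this
  · simp only [List.nodup_cons, List.mem_cons, not_or]
    exact ⟨⟨hi10, S.notMem_path h⟩, hi0, hnd⟩
  · simpa [Nat.odd_add, parity_simps] using hodd
  · rintro (_ | _ | k) hk hk2
    · simp at hk2
    · exact hcross
    · simp only [List.length_cons] at hk
      simp only [List.getD_cons_succ]
      obtain ⟨e, f, hef, hi⟩ := S.numbering.exists_joins (T := T) (es.getD k (edef n))
      obtain ⟨h1, h2, h3, -⟩ := S.bounds_of_odd h (k := k) (by dsimp only; omega) (by omega) hef hi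
      exact eCross_ab_of_bounds S.numbering hi (by omega) h2 h3
  · rintro (_ | _ | j) (_ | _ | k) hjk hk
    · omega
    · simp [S.crossPts_first_eq_empty]
    · simp [S.crossPts_first_eq_empty]
    · omega
    · omega
    · simp only [List.length_cons] at hk
      simp only [List.getD_cons_succ, List.getD_cons_zero]
      apply S.dist_lt_of_ne
      rw [List.getD_eq_getElem _ _ (by omega)]
      intro he
      exact hi0 (he ▸ List.getElem_mem _)
    · omega
    · omega
    · simp only [List.length_cons] at hk
      simp only [List.getD_cons_succ]
      intro x hx y hy
      obtain ⟨e, f, hef, hi⟩ := S.numbering.exists_joins (T := T) (es.getD j (edef n))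
      obtain ⟨e', f', hef', hi'⟩ := S.numbering.exists_joins (T := T) (es.getD k (edef n))
      obtain ⟨h1, h2, h3, -⟩ := S.bounds_of_eCross_ab hef hi (eCross_of_mem_crossPts hx)
      obtain ⟨-, h2', h3', -⟩ := S.bounds_of_eCross_ab hef' hi' (eCross_of_mem_crossPts hy)
      have hce' : r c < r e' := by
        have l1 := S.lt_vertex h (k := k) (by omega) (by dsimp only; omega)
        have l2 := S.lt_vertex h (k := k + 1) (by omega) (by dsimp only; omega)
        rcases (hj k (by omega)).samePair hi' with ⟨h, -⟩ | ⟨-, h⟩ <;> rw [← h] <;> assumption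
      exact S.numbering.closer_transfer (h.getD_ne (by omega) (by dsimp only; omega)) hi hi'
        h2 h3 h2' h3' (by omega) hce' (h6 j k (by omega) (by omega)) x hx y hy

lemma CutTriangle.isTPath_of_cons_cons (S : CutTriangle n T r ε a b c d i0 i1)
    {vs : List (Fin (n + 3))} {es : List (Fin (2 * n + 3))}
    (h : IsTPath n T a b (a :: d :: c :: vs, i1 :: i0 :: es)) :
    IsTPath n T c b (c :: vs, es) ∧ i0 ∉ es := by
  have h' := h
  obtain ⟨hl, -, hlast, hj, hnd, hodd, h5, h6⟩ := h'
  dsimp only at hl hlast hj hnd hodd h5 h6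
  simp only [List.length_cons] at hl hj h5 h6
  simp only [List.nodup_cons, List.mem_cons, not_or] at hnd
  have hc := S.base_lt
  have hj' : ∀ k, k < es.length →
      Joins n T (es.getD k (edef n)) ((c :: vs).getD k c) ((c :: vs).getD (k + 1) c) := by
    intro k hk
    have := hj (k + 2) (by omega)
    rw [getD_congr (c :: vs) (x := c) (y := a) (by simp; omega),
      getD_congr (c :: vs) (x := c) (y := a) (by simp; omega)]
    exact this
  have hne : ∀ j k, j < k → k < es.length → es.getD j (edef n) ≠ es.getD k (edef n) := by
    intro j k hjk hk
    simpa using h.getD_ne (j := j + 2) (k := k + 2) (by omega) (by simp; omega)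
  have h5' : ∀ k, k < es.length → k % 2 = 1 → ECross n T (es.getD k (edef n)) a b := by
    intro k hk hk2
    simpa using h5 (k + 2) (by omega) (by omega)
  have h6' : ∀ j k, j < k → k < es.length → ∀ x ∈ crossPts n T (es.getD j (edef n)) a b,
      ∀ y ∈ crossPts n T (es.getD k (edef n)) a b, dist (vtx n a) x < dist (vtx n a) y := by
    intro j k hjk hk
    simpa using h6 (j + 2) (k + 2) (by omega) (by omega)
  have hlt1 : ∀ e f, r e < r f → 1 < es.length → Joins n T (es.getD 1 (edef n)) e f →
      r c < r e := by
    intro e f hef hlen hi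
    have hb := S.bounds_of_eCross_ab hef hi (h5' 1 hlen rfl)
    refine hb.1.lt_of_ne fun hce => ?_
    have j0 := hj' 0 (by omega)
    have j1 := hj' 1 hlen
    obtain rfl := S.numbering.injective hce
    refine hne 0 1 one_pos hlen (j0.index_eq ?_)
    rcases hi.samePair j1 with ⟨h, -⟩ | ⟨h, h'⟩
    · exact absurd h j0.ne
    · have e1 : (c :: vs).getD 0 c = c := rfl
      rw [e1, ← h']
      exact hi
  refine ⟨⟨by simpa using hl, rfl, by simpa using hlast, hj', hnd.2.2, ?_, ?_, ?_⟩, hnd.2.1⟩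
  · simpa [Nat.odd_add, parity_simps] using hodd
  · intro k hk hk2
    dsimp only at hk ⊢
    obtain ⟨e, f, hef, hi⟩ := S.numbering.exists_joins (T := T) (es.getD k (edef n))
    obtain ⟨b1, b2, b3, -⟩ := S.bounds_of_eCross_ab hef hi (h5' k hk hk2)
    refine eCross_ab_of_bounds S.numbering hi ?_ b2 b3
    obtain ⟨e', f', hef', hi'⟩ := S.numbering.exists_joins (T := T) (es.getD 1 (edef n))
    have hce' := hlt1 e' f' hef' (by omega) hi'
    by_cases hk1 : k = 1
    · subst hk1
      exact hlt1 e f hef hk hi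
    · obtain ⟨-, c2, c3, -⟩ := S.bounds_of_eCross_ab hef' hi' (h5' 1 (by omega) rfl)
      exact hce'.trans_le (S.numbering.left_le_of_closer hi' hi c2 c3 b2 b3
        (by omega) (by omega) (h6' 1 k (by omega) hk))
  · intro j k hjk hk x hx y hy
    dsimp only at hk hx hy ⊢
    obtain ⟨e, f, hef, hi⟩ := S.numbering.exists_joins (T := T) (es.getD j (edef n))
    obtain ⟨e', f', hef', hi'⟩ := S.numbering.exists_joins (T := T) (es.getD k (edef n))
    have hcr := eCross_of_mem_crossPts hx
    have hcr' := eCross_of_mem_crossPts hy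
    have hjk' := hne j k hjk hk
    obtain ⟨b1, b2, b3, -⟩ := S.bounds_of_eCross_cb hef hi
      (fun hcb => not_eCross_of_joins hcb hjk'.symm hcr') hcr
    obtain ⟨c1, c2, c3, -⟩ := S.bounds_of_eCross_cb hef' hi'
      (fun hcb => not_eCross_of_joins hcb hjk' hcr) hcr'
    exact S.numbering.closer_transfer hjk' hi hi' b2 b3 c2 c3 b1 (by omega) (h6' j k hjk hk)
      x hx y hy

end Paths

lemma exists_cutTriangle {n : ℕ} {T : Triangulation n} {a b c d : Fin (n + 3)}
    {i0 i1 i1' : Fin (2 * n + 3)} (hab : a ≠ b) (hM : ¬ ∃ i, Joins n T i a b)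
    (hi0M : ECross n T i0 a b) (hcd : Joins n T i0 c d) (hi1' : Joins n T i1' a c)
    (hi1 : Joins n T i1 a d) : ∃ r ε, CutTriangle n T r ε a b c d i0 i1 := by
  obtain ⟨r, ε, hr, ha, hlt⟩ := exists_isNumbering hi1.ne hcd.ne
  have hac := hr.injective.ne hi1'.ne
  have hab' := hr.injective.ne hab
  rw [hcd.eCross_iff, hr.cross_iff hlt (by omega) (.inl hi1'.ne.symm)] at hi0M
  exact ⟨r, ε, hr, by omega, by omega, by omega, by omega, hcd, hi1, ⟨i1', hi1'⟩,
    fun i hi => hM ⟨i, hi⟩⟩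

lemma pathX_cons_cons {n : ℕ} (i j : Fin (2 * n + 3)) (es : List (Fin (2 * n + 3))) :
    pathX n (i :: j :: es) = X n i / X n j * pathX n es := by
  simp only [pathX, Finset.prod_filter, List.length_cons, Finset.prod_range_succ',
    List.getD_cons_succ, List.getD_cons_zero]
  have h0 : ∀ k : ℕ, (k + 1 + 1) % 2 = k % 2 := by omega
  simp only [h0]
  norm_num
  ring

/-- Lemma 2.6, the map `g`. -/
theorem bijOn_g
    (n : ℕ) (hn : 1 ≤ n) (T : Triangulation n) (a b c d : Fin (n + 3))
    (i0 i1 i1' : Fin (2 * n + 3))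
    (hab : a ≠ b) (hnadj : ¬ Adj n a b)
    (hM : ¬ ∃ i : Fin (2 * n + 3), Joins n T i a b)
    (hi0d : i0.val < n) (hi0M : ECross n T i0 a b)
    (hclosest : ∀ j : Fin (2 * n + 3), j.val < n → ECross n T j a b → j ≠ i0 →
      ∀ x ∈ crossPts n T i0 a b, ∀ y ∈ crossPts n T j a b,
        dist (vtx n a) x < dist (vtx n a) y)
    (hcd : Joins n T i0 c d)
    (hi1' : Joins n T i1' a c) (hi1 : Joins n T i1 a d)
    :
    Set.BijOn (fun γ : PathData n => ((a :: d :: γ.1, i1 :: i0 :: γ.2) : PathData n))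
      (TPathsAvoid n T c b i0) (TPathsFirst2 n T a b i1 i0) ∧
    ∀ γ ∈ TPathsAvoid n T c b i0,
      pathX n (i1 :: i0 :: γ.2) = X n i1 / X n i0 * pathX n γ.2 := by
  obtain ⟨r, ε, S⟩ := exists_cutTriangle hab hM hi0M hcd hi1' hi1
  refine ⟨⟨?_, ?_, ?_⟩, fun γ _ => pathX_cons_cons i1 i0 γ.2⟩
  · rintro ⟨vs, es⟩ ⟨h, hi0⟩
    exact ⟨⟨S.isTPath_cons_cons hi0M h hi0, rfl⟩, rfl⟩
  · rintro ⟨vs, es⟩ - ⟨vs', es'⟩ - h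
    simpa using h
  · rintro ⟨vs, es⟩ ⟨⟨h, h1⟩, h2⟩
    obtain ⟨es, rfl⟩ : ∃ l, es = i1 :: i0 :: l := by
      rcases es with _ | ⟨i, _ | ⟨j, es⟩⟩ <;> simp_all
    have ⟨hl, hhead, _, hj, _, hodd, _⟩ := h
    obtain ⟨u, v, w, vs, rfl⟩ : ∃ u v w l, vs = u :: v :: w :: l := by
      rcases vs with _ | ⟨u, _ | ⟨v, _ | ⟨w, vs⟩⟩⟩
      · simp at hl
      · simp at hl
      · simp_all
      · exact ⟨u, v, w, vs, rfl⟩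
    obtain rfl : u = a := by simpa using hhead
    have j0 : Joins n T i1 u v := hj 0 (by simp)
    have j1 : Joins n T i0 v w := hj 1 (by simp)
    obtain rfl : v = d := by
      rcases j0.samePair hi1 with ⟨-, h⟩ | ⟨h, -⟩
      · exact h
      · exact absurd h hi1.ne
    obtain rfl : w = c := by
      rcases j1.samePair hcd with ⟨h, -⟩ | ⟨-, h⟩
      · exact absurd h.symm hcd.ne
      · exact h
    exact ⟨(w :: vs, es), S.isTPath_of_cons_cons h, rfl⟩
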